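/- arXiv:2301.09481 — 2 statements merged into one kernel-verified Lean document; each statement's English description precedes it below -/
import Mathlib

section
/- Let T ∈ B(L¹(ℝ₊)) be Hankelian. Then there exists a bounded (complex) Borel measure ν on (0,∞) with total variation ‖ν‖ ≤ ‖T‖ such that ⟨T f, g⟩ = ∫_{(0,∞)} (f ∗ g)(u) dν(u) for all f ∈ L¹(ℝ₊) and g ∈ C₀((0,∞)), i.e. T = H_ν; consequently ‖ν‖ = ‖T‖, and ν ↦ H_ν is an isometric isomorphism from the space M((0,∞)) of bounded measures onto the space Hank₁(ℝ₊) of Hankel operators on L¹(ℝ₊). -/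
open scoped ENNReal
open MeasureTheory

/-- Lebesgue measure on `ℝ₊ = (0,∞)`. -/
noncomputable def muplus : Measure ℝ := volume.restrict (Set.Ioi 0)

/-- The translate `τ_v f` of a function on `ℝ₊`. -/
noncomputable def shiftR (v : ℝ) (f : ℝ → ℂ) : ℝ → ℂ := fun t => if v < t then f (t - v) else 0

/-- `T ∈ B(L^p(ℝ₊))` is Hankelian: `⟨T(τ_v f), g⟩ = ⟨T f, τ_v g⟩` (`g` in `L^{p'}`). -/
def IsHankelianLp (p q : ℝ≥0∞) [Fact (1 ≤ p)] [Fact (1 ≤ q)]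
    (T : Lp ℂ p muplus →L[ℂ] Lp ℂ p muplus) : Prop :=
  ∀ v : ℝ, 0 < v → ∀ (f fv : Lp ℂ p muplus) (g : Lp ℂ q muplus) (gv : Lp ℂ q muplus),
    (fv : ℝ → ℂ) =ᵐ[muplus] shiftR v (f : ℝ → ℂ) →
    (gv : ℝ → ℂ) =ᵐ[muplus] shiftR v (g : ℝ → ℂ) →
    ∫ t, (T fv : ℝ → ℂ) t * (g : ℝ → ℂ) t ∂muplus
      = ∫ t, (T f : ℝ → ℂ) t * (gv : ℝ → ℂ) t ∂muplus

lemma ulim_exists {E : Type*} [NormedAddCommGroup E] [ProperSpace E] (a : ℕ → E) (C : ℝ)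
    (ha : ∀ n, ‖a n‖ ≤ C) :
    ∃ l, Filter.Tendsto a (Filter.hyperfilter ℕ) (nhds l) := by
  have hc : IsCompact (Metric.closedBall (0 : E) C) := isCompact_closedBall _ _
  obtain ⟨l, _, hl⟩ := hc.ultrafilter_le_nhds ((Filter.hyperfilter ℕ).map a) (by
    simp only [Filter.le_principal_iff, Ultrafilter.coe_map, Filter.mem_map]
    apply Filter.univ_mem'
    intro n
    simpa using ha n)
  exact ⟨l, hl⟩

/-- duality -/
lemma dual_norm (μ : Measure ℝ) [IsLocallyFiniteMeasure μ] (h0 : μ (Set.Iic 0) = 0)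
    (φ : ℝ → ℂ) (hφ : Integrable φ μ) (C : ℝ)
    (hC : ∀ g : ℝ → ℂ, Continuous g → HasCompactSupport g → (∀ t ≤ 0, g t = 0) →
      (∀ t, ‖g t‖ ≤ 1) → ‖∫ t, φ t * g t ∂μ‖ ≤ C) :
    ∫ t, ‖φ t‖ ∂μ ≤ C := by
  apply le_of_forall_pos_le_add
  intro ε hε
  obtain ⟨ψ, hψc, hψ, hψcont, hψi⟩ := hφ.exists_hasCompactSupport_integral_sub_le (half_pos hε)
  let χ : ℕ → ℝ → ℝ := fun n t => min 1 (max 0 (n * t))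
  have hχ0 : ∀ n t, 0 ≤ χ n t := fun n t => le_min zero_le_one (le_max_left _ _)
  have hχ1 : ∀ n t, χ n t ≤ 1 := fun n t => min_le_left _ _
  have hpos : ∀ (n : ℕ) t, 0 < ‖ψ t‖ + 1 / ((n : ℝ) + 1) := fun n t => by positivity
  let g : ℕ → ℝ → ℂ := fun n t =>
    (starRingEnd ℂ) (ψ t) * (((χ n t) / (‖ψ t‖ + 1 / ((n : ℝ) + 1)) : ℝ) : ℂ)
  have hg1 : ∀ n t, ‖g n t‖ ≤ 1 := by
    intro n t
    simp only [g, norm_mul, RCLike.norm_conj, Complex.norm_real, Real.norm_eq_abs]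
    rw [abs_of_nonneg (div_nonneg (hχ0 n t) (hpos n t).le), ← mul_div_assoc,
      div_le_one (hpos n t)]
    have : ‖ψ t‖ * χ n t ≤ ‖ψ t‖ * 1 := mul_le_mul_of_nonneg_left (hχ1 n t) (norm_nonneg _)
    have : 0 < 1 / ((n : ℝ) + 1) := by positivity
    linarith
  have hgc : ∀ n, Continuous (g n) := by
    intro n
    simp only [g, χ]
    refine (Complex.continuous_conj.comp hψcont).mul (Complex.continuous_ofReal.comp ?_)
    exact Continuous.div (by fun_prop) (by fun_prop) (fun t => (hpos n t).ne')
  have hgs : ∀ n, HasCompactSupport (g n) := fun n =>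
    hψc.mono (fun t ht hψt => ht (by simp [g, hψt]))
  have hg0 : ∀ n, ∀ t ≤ 0, g n t = 0 := by
    intro n t ht
    have : χ n t = 0 := by
      simp only [χ]
      rw [max_eq_left (mul_nonpos_of_nonneg_of_nonpos (Nat.cast_nonneg n) ht)]
      simp
    simp [g, this]
  have hφg : ∀ n, Integrable (fun t => φ t * g n t) μ := fun n =>
    hφ.mul_bdd (c := 1) (hgc n).aestronglyMeasurable (Filter.Eventually.of_forall (hg1 n))
  have hψg : ∀ n, Integrable (fun t => ψ t * g n t) μ := fun n =>
    hψi.mul_bdd (c := 1) (hgc n).aestronglyMeasurable (Filter.Eventually.of_forall (hg1 n))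
  have hbound : ∀ n, ‖∫ t, ψ t * g n t ∂μ‖ ≤ C + ε / 2 := by
    intro n
    have e : ∫ t, ψ t * g n t ∂μ = ∫ t, φ t * g n t ∂μ - ∫ t, (φ t - ψ t) * g n t ∂μ := by
      rw [← integral_sub (hφg n)]
      · congr 1; ext t; ring
      · exact ((hφg n).sub (hψg n)).congr (Filter.Eventually.of_forall fun t => by
          simp [sub_mul])
    rw [e]
    refine (norm_sub_le _ _).trans (add_le_add (hC _ (hgc n) (hgs n) (hg0 n) (hg1 n)) ?_)
    refine (norm_integral_le_integral_norm _).trans (le_trans ?_ hψ)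
    refine integral_mono_of_nonneg (Filter.Eventually.of_forall fun t => norm_nonneg _)
      (hφ.sub hψi).norm (Filter.Eventually.of_forall fun t => ?_)
    simp only [norm_mul]
    exact mul_le_of_le_one_right (norm_nonneg _) (hg1 n t)
  have hlim : Filter.Tendsto (fun n => ∫ t, ψ t * g n t ∂μ) Filter.atTop
      (nhds (∫ t, ((‖ψ t‖ : ℝ) : ℂ) ∂μ)) := by
    refine tendsto_integral_of_dominated_convergence (fun t => ‖ψ t‖)
      (fun n => (hψg n).aestronglyMeasurable) hψi.norm ?_ ?_
    · intro n
      refine Filter.Eventually.of_forall fun t => ?_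
      rw [norm_mul]
      exact mul_le_of_le_one_right (norm_nonneg _) (hg1 n t)
    · have : ∀ᵐ t ∂μ, t ∉ Set.Iic (0:ℝ) := measure_eq_zero_iff_ae_notMem.1 h0
      filter_upwards [this] with t ht
      have ht : 0 < t := by simpa using ht
      by_cases hz : ψ t = 0
      · simp [hz]
      have hz' : ‖ψ t‖ ≠ 0 := by simpa using hz
      have h1 : Filter.Tendsto (fun n : ℕ => χ n t) Filter.atTop (nhds 1) := by
        apply tendsto_const_nhds.congr'
        obtain ⟨N, hN⟩ := exists_nat_gt (1 / t)
        filter_upwards [Filter.eventually_ge_atTop N] with n hn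
        have : 1 ≤ n * t := by
          have : (N : ℝ) ≤ n := by exact_mod_cast hn
          have h2 : 1 / t * t = 1 := by field_simp
          nlinarith
        simp only [χ]
        rw [max_eq_right (by linarith), min_eq_left this]
      have h2 : Filter.Tendsto (fun n : ℕ => (‖ψ t‖ + 1 / ((n : ℝ) + 1))) Filter.atTop
          (nhds (‖ψ t‖ + 0)) := tendsto_const_nhds.add tendsto_one_div_add_atTop_nhds_zero_nat
      rw [add_zero] at h2
      have h3 := (tendsto_const_nhds (x := ‖ψ t‖ ^ 2)).mul (h1.div h2 hz')
      have h4 := (Complex.continuous_ofReal.tendsto _).comp h3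
      have e1 : ‖ψ t‖ ^ 2 * (1 / ‖ψ t‖) = ‖ψ t‖ := by field_simp
      rw [e1] at h4
      refine h4.congr fun n => ?_
      simp only [Function.comp, g, ← mul_assoc, Complex.mul_conj, Complex.normSq_eq_norm_sq]
      simp only [Pi.div_apply]
      push_cast
      rfl
  have hle := le_of_tendsto hlim.norm (Filter.Eventually.of_forall hbound)
  rw [integral_complex_ofReal, Complex.norm_real, Real.norm_of_nonneg
    (integral_nonneg fun _ => norm_nonneg _)] at hle
  have : ∫ t, ‖φ t‖ ∂μ ≤ ∫ t, ‖φ t - ψ t‖ ∂μ + ∫ t, ‖ψ t‖ ∂μ := by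
    have hsub : Integrable (fun t => ‖φ t - ψ t‖) μ := (hφ.sub hψi).norm
    rw [← integral_add hsub hψi.norm]
    refine integral_mono hφ.norm (hsub.add hψi.norm) fun t => ?_
    simpa using norm_add_le (φ t - ψ t) (ψ t)
  linarith

open CompactlySupported in
lemma weak_limit (μ : Measure ℝ) (φ : ℕ → ℝ → ℂ) (hφ : ∀ n, Integrable (φ n) μ) (C : ℝ)
    (hC : ∀ n, ∫ t, ‖φ n t‖ ∂μ ≤ C) :
    ∃ (ρ : Measure ℝ) (h : ℝ → ℂ), IsFiniteMeasure ρ ∧ Measurable h ∧ Integrable h ρ ∧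
      ∀ g : ℝ → ℂ, Continuous g → HasCompactSupport g →
        Filter.Tendsto (fun n => ∫ t, φ n t * g t ∂μ) (Filter.hyperfilter ℕ)
          (nhds (∫ t, g t * h t ∂ρ)) := by
  have hC0 : 0 ≤ C := (integral_nonneg fun _ => norm_nonneg _).trans (hC 0)
  have hbd : ∀ g : ℝ → ℂ, Continuous g → HasCompactSupport g → ∃ K, ∀ t, ‖g t‖ ≤ K :=
    fun g h1 h2 => h1.bounded_above_of_compact_support h2
  have hbdR : ∀ g : ℝ → ℝ, Continuous g → HasCompactSupport g → ∃ K, ∀ t, ‖g t‖ ≤ K :=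
    fun g h1 h2 => h1.bounded_above_of_compact_support h2
  have hiR : ∀ n (g : C_c(ℝ, ℝ)), Integrable (fun t => ‖φ n t‖ * g t) μ := by
    intro n g
    obtain ⟨K, hK⟩ := hbdR g g.continuous g.hasCompactSupport
    exact (hφ n).norm.mul_bdd (c := K) g.continuous.aestronglyMeasurable
      (Filter.Eventually.of_forall hK)
  have hiC : ∀ n (g : C_c(ℝ, ℂ)), Integrable (fun t => φ n t * g t) μ := by
    intro n g
    obtain ⟨K, hK⟩ := hbd g g.continuous g.hasCompactSupport
    exact (hφ n).mul_bdd (c := K) g.continuous.aestronglyMeasurable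
      (Filter.Eventually.of_forall hK)
  have hR1 : ∀ n (g : C_c(ℝ, ℝ)) K, (∀ t, ‖g t‖ ≤ K) → ‖∫ t, ‖φ n t‖ * g t ∂μ‖ ≤ C * K := by
    intro n g K hK
    have hK0 : 0 ≤ K := (norm_nonneg _).trans (hK 0)
    refine (norm_integral_le_integral_norm _).trans ?_
    refine le_trans (integral_mono (hiR n g).norm ((hφ n).norm.mul_const K) fun t => ?_) ?_
    · simp only [norm_mul, norm_norm]
      exact mul_le_mul_of_nonneg_left (hK t) (norm_nonneg _)
    · rw [integral_mul_const]
      exact mul_le_mul_of_nonneg_right (hC n) hK0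
  have hexR : ∀ g : C_c(ℝ, ℝ), ∃ l, Filter.Tendsto (fun n => ∫ t, ‖φ n t‖ * g t ∂μ)
      (Filter.hyperfilter ℕ) (nhds l) := by
    intro g
    obtain ⟨K, hK⟩ := hbdR g g.continuous g.hasCompactSupport
    exact ulim_exists _ (C * K) fun n => hR1 n g K hK
  choose P hP using hexR
  let Plin : C_c(ℝ, ℝ) →ₗ[ℝ] ℝ :=
    { toFun := P
      map_add' := fun f g => by
        refine tendsto_nhds_unique (hP (f + g)) (((hP f).add (hP g)).congr fun n => ?_)
        rw [← integral_add (hiR n f) (hiR n g)]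
        congr 1; ext t; simp [mul_add]
      map_smul' := fun c g => by
        refine tendsto_nhds_unique (hP (c • g)) (((hP g).const_mul c).congr fun n => ?_)
        rw [← integral_const_mul]
        congr 1; ext t; simp; ring }
  let PP : C_c(ℝ, ℝ) →ₚ[ℝ] ℝ := PositiveLinearMap.mk₀ Plin (by
    intro g hg
    refine ge_of_tendsto (hP g) (Filter.Eventually.of_forall fun n => ?_)
    exact integral_nonneg fun t => mul_nonneg (norm_nonneg _) (hg t))
  have hPP : ∀ g, PP g = P g := fun g => rfl
  let ρ := RealRMK.rieszMeasure PP
  have hρint : ∀ g : C_c(ℝ, ℝ), ∫ t, g t ∂ρ = P g := fun g => RealRMK.integral_rieszMeasure PP g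
  have hρuniv : ρ Set.univ ≤ ENNReal.ofReal C := by
    rw [isOpen_univ.measure_eq_iSup_isCompact]
    refine iSup₂_le fun K _ => iSup_le fun hK => ?_
    obtain ⟨f, hf1, hf0, hfs, hf01⟩ := exists_continuous_one_zero_of_isCompact hK isClosed_empty
      (Set.disjoint_empty K)
    let F : C_c(ℝ, ℝ) := ⟨f, hfs⟩
    have := RealRMK.rieszMeasure_le_of_eq_one PP (f := F) (fun x => (hf01 x).1) hK
      (fun x hx => hf1 hx)
    refine this.trans (ENNReal.ofReal_le_ofReal ?_)
    rw [hPP]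
    refine le_of_tendsto (hP F) (Filter.Eventually.of_forall fun n => ?_)
    have := hR1 n F 1 (fun t => by
      have := hf01 t
      change ‖f t‖ ≤ 1
      rw [Real.norm_of_nonneg this.1]; exact this.2)
    exact (le_abs_self _).trans (by simpa using this)
  have hfin : IsFiniteMeasure ρ := ⟨hρuniv.trans_lt ENNReal.ofReal_lt_top⟩
  -- complex functional
  have hexC : ∀ g : C_c(ℝ, ℂ), ∃ l, Filter.Tendsto (fun n => ∫ t, φ n t * g t ∂μ)
      (Filter.hyperfilter ℕ) (nhds l) ∧ ‖l‖ ≤ ∫ t, ‖g t‖ ∂ρ := by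
    intro g
    let G : C_c(ℝ, ℝ) := ⟨⟨fun t => ‖g t‖, g.continuous.norm⟩, g.hasCompactSupport.norm⟩
    have hle : ∀ n, ‖∫ t, φ n t * g t ∂μ‖ ≤ ∫ t, ‖φ n t‖ * G t ∂μ := by
      intro n
      refine (norm_integral_le_integral_norm _).trans (le_of_eq ?_)
      congr 1; ext t; simp [G]
    obtain ⟨K, hK⟩ := hbdR G G.continuous G.hasCompactSupport
    obtain ⟨l, hl⟩ := ulim_exists (fun n => ∫ t, φ n t * g t ∂μ) (C * K) fun n =>
      (hle n).trans ((le_abs_self _).trans (hR1 n G K hK))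
    refine ⟨l, hl, ?_⟩
    have := le_of_tendsto_of_tendsto' hl.norm (hP G) hle
    rwa [← hρint] at this
  choose L hL hLb using hexC
  let Llin : C_c(ℝ, ℂ) →ₗ[ℂ] ℂ :=
    { toFun := L
      map_add' := fun f g => by
        refine tendsto_nhds_unique (hL (f + g)) (((hL f).add (hL g)).congr fun n => ?_)
        rw [← integral_add (hiC n f) (hiC n g)]
        congr 1; ext t; simp [mul_add]
      map_smul' := fun c g => by
        refine tendsto_nhds_unique (hL (c • g)) (((hL g).const_mul c).congr fun n => ?_)
        rw [← integral_const_mul]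
        congr 1; ext t; simp; ring }
  have hmem : ∀ g : C_c(ℝ, ℂ), MemLp g 2 ρ := fun g =>
    g.continuous.memLp_of_hasCompactSupport g.hasCompactSupport
  let J : C_c(ℝ, ℂ) →ₗ[ℂ] Lp ℂ 2 ρ :=
    { toFun := fun g => (hmem g).toLp g
      map_add' := fun f g => by
        rw [← MemLp.toLp_add]; rfl
      map_smul' := fun c g => by
        simp only [RingHom.id_apply]
        rw [← MemLp.toLp_const_smul]; rfl }
  have hdense : DenseRange J := by
    intro f
    rw [Metric.mem_closure_iff]
    intro ε hε
    obtain ⟨g, hgs, hg, hgc, hgm⟩ := (Lp.memLp f).exists_hasCompactSupport_eLpNorm_sub_le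
      (by norm_num) (ε := ENNReal.ofReal (ε / 2)) (by simpa using hε)
    let G : C_c(ℝ, ℂ) := ⟨⟨g, hgc⟩, hgs⟩
    refine ⟨J G, ⟨G, rfl⟩, ?_⟩
    have : dist f (J G) ≤ ε / 2 := by
      rw [Lp.dist_def]
      refine ENNReal.toReal_le_of_le_ofReal (by positivity) (le_trans (le_of_eq ?_) hg)
      refine eLpNorm_congr_ae ?_
      filter_upwards [(hmem G).coeFn_toLp] with t ht
      simp only [Pi.sub_apply]
      congr 1
    linarith
  have hnorm : ∀ g, ‖Llin g‖ ≤ (ρ Set.univ).toReal ^ (1 / 2 : ℝ) * ‖J g‖ := by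
    intro g
    refine (hLb g).trans ?_
    have hgm : AEStronglyMeasurable (g : ℝ → ℂ) ρ := g.continuous.aestronglyMeasurable
    have h1 : ∫ t, ‖g t‖ ∂ρ = (eLpNorm g 1 ρ).toReal := by
      rw [integral_norm_eq_lintegral_enorm hgm,
        eLpNorm_one_eq_lintegral_enorm]
    have h2 := eLpNorm_le_eLpNorm_mul_rpow_measure_univ (p := 1) (q := 2) (by norm_num) hgm
    rw [h1]
    have h3 : ‖J g‖ = (eLpNorm g 2 ρ).toReal := by simp [J, Lp.norm_toLp]
    rw [h3, mul_comm, ENNReal.toReal_rpow, ← ENNReal.toReal_mul]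
    refine ENNReal.toReal_mono ?_ ?_
    · exact ENNReal.mul_ne_top (hmem g).2.ne
        (ENNReal.rpow_ne_top_of_nonneg (by norm_num) (measure_ne_top _ _))
    · convert h2 using 3
      rw [ENNReal.toReal_one, ENNReal.toReal_ofNat]
      norm_num
  let ℓ := Llin.extendOfNorm J
  let k : Lp ℂ 2 ρ := (InnerProductSpace.toDual ℂ (Lp ℂ 2 ρ)).symm ℓ
  have hk : ∀ f, inner ℂ k f = ℓ f := fun f => InnerProductSpace.toDual_symm_apply
  have hkm : AEStronglyMeasurable (k : ℝ → ℂ) ρ := (Lp.memLp k).1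
  have hki : Integrable (k : ℝ → ℂ) ρ := (Lp.memLp k).integrable (by norm_num)
  let k' := hkm.mk k
  have hk' : (k : ℝ → ℂ) =ᵐ[ρ] k' := hkm.ae_eq_mk
  refine ⟨ρ, fun t => (starRingEnd ℂ) (k' t), hfin, ?_, ?_, ?_⟩
  · exact Complex.continuous_conj.measurable.comp hkm.stronglyMeasurable_mk.measurable
  · have : Integrable k' ρ := hki.congr hk'
    refine this.mono (Complex.continuous_conj.comp_aestronglyMeasurable this.1) ?_
    exact Filter.Eventually.of_forall fun t => by simp
  · intro g hgc hgs
    let G : C_c(ℝ, ℂ) := ⟨⟨g, hgc⟩, hgs⟩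
    have h1 : ℓ (J G) = L G := LinearMap.extendOfNorm_eq hdense ⟨_, hnorm⟩ G
    have h2 : ∫ t, g t * (starRingEnd ℂ) (k' t) ∂ρ = L G := by
      rw [← h1, ← hk, L2.inner_def]
      refine integral_congr_ae ?_
      filter_upwards [hk', (hmem G).coeFn_toLp] with t h3 h4
      have h5 : (J G : ℝ → ℂ) t = g t := h4
      rw [h5, h3]
      simp
    rw [h2]
    exact hL G

instance : IsLocallyFiniteMeasure muplus := by unfold muplus; infer_instance

lemma ae_pos : ∀ᵐ t ∂muplus, 0 < t := by
  unfold muplus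
  exact ae_restrict_mem measurableSet_Ioi

lemma muplus_Iic : muplus (Set.Iic 0) = 0 := by
  unfold muplus
  rw [Measure.restrict_apply measurableSet_Iic]
  simp [Set.Iic_inter_Ioi]

/-- convolution on the half-line -/
noncomputable def cv (f g : ℝ → ℂ) (u : ℝ) : ℂ := ∫ v, f v * g (u - v) ∂muplus

lemma cv_eq (f g : ℝ → ℂ) (hg : ∀ t ≤ 0, g t = 0) (u : ℝ) :
    ∫ t in Set.Ioo 0 u, f (u - t) * g t = cv f g u := by
  unfold cv muplus
  rw [← integral_indicator measurableSet_Ioo, ← integral_indicator measurableSet_Ioi,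
    ← integral_sub_left_eq_self _ volume u]
  congr 1; ext t
  simp only [Set.indicator, Set.mem_Ioo, Set.mem_Ioi, sub_sub_cancel]
  by_cases h1 : 0 < t
  · by_cases h2 : t < u
    · rw [if_pos ⟨by linarith, by linarith⟩, if_pos h1]
    · rw [if_neg (fun h => h2 (by linarith [h.1])), if_pos h1, hg (u - t) (by linarith), mul_zero]
  · rw [if_neg (fun h => h1 (by linarith [h.2])), if_neg h1]

lemma cv_continuous {f g : ℝ → ℂ} (hf : Integrable f muplus) (hg : Continuous g) (K : ℝ)
    (hK : ∀ t, ‖g t‖ ≤ K) : Continuous (cv f g) := by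
  unfold cv
  refine continuous_of_dominated (bound := fun v => ‖f v‖ * K) ?_ ?_ (hf.norm.mul_const K) ?_
  · intro u
    exact hf.1.mul (by fun_prop : Continuous fun v => g (u - v)).aestronglyMeasurable
  · intro u
    refine Filter.Eventually.of_forall fun v => ?_
    rw [norm_mul]
    exact mul_le_mul_of_nonneg_left (hK _) (norm_nonneg _)
  · exact Filter.Eventually.of_forall fun v => by fun_prop

lemma cv_integrable {f g : ℝ → ℂ} (hf : Integrable f muplus) (hg : Continuous g) (K : ℝ)
    (hK : ∀ t, ‖g t‖ ≤ K) (u : ℝ) : Integrable (fun v => f v * g (u - v)) muplus :=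
  hf.mul_bdd (c := K) (by fun_prop : Continuous fun v => g (u - v)).aestronglyMeasurable
    (Filter.Eventually.of_forall fun v => hK _)

lemma cv_bound {f g : ℝ → ℂ} (hf : Integrable f muplus) (K : ℝ)
    (hK : ∀ t, ‖g t‖ ≤ K) (u : ℝ) : ‖cv f g u‖ ≤ (∫ t, ‖f t‖ ∂muplus) * K := by
  unfold cv
  refine (norm_integral_le_integral_norm _).trans ?_
  rw [← integral_mul_const]
  refine integral_mono_of_nonneg (Filter.Eventually.of_forall fun t => norm_nonneg _)
    (hf.norm.mul_const K) (Filter.Eventually.of_forall fun t => ?_)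
  simp only [norm_mul]
  exact mul_le_mul_of_nonneg_left (hK _) (norm_nonneg _)

lemma pair_integrable (φ : Lp ℂ 1 muplus) {g : ℝ → ℂ} (hg : Continuous g) {K : ℝ}
    (hK : ∀ t, ‖g t‖ ≤ K) : Integrable (fun t => (φ : ℝ → ℂ) t * g t) muplus :=
  (L1.integrable_coeFn φ).mul_bdd (c := K) hg.aestronglyMeasurable
    (Filter.Eventually.of_forall hK)

/-- pairing with a bounded continuous function -/
noncomputable def pairL (g : ℝ → ℂ) (K : ℝ) (hg : Continuous g) (hK : ∀ t, ‖g t‖ ≤ K) :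
    Lp ℂ 1 muplus →L[ℂ] ℂ :=
  LinearMap.mkContinuous
    { toFun := fun φ => ∫ t, (φ : ℝ → ℂ) t * g t ∂muplus
      map_add' := fun φ ψ => by
        rw [← integral_add (pair_integrable φ hg hK) (pair_integrable ψ hg hK)]
        refine integral_congr_ae ?_
        filter_upwards [Lp.coeFn_add φ ψ] with t ht
        rw [ht]; simp [add_mul]
      map_smul' := fun c φ => by
        simp only [RingHom.id_apply, smul_eq_mul]
        rw [← integral_const_mul]
        refine integral_congr_ae ?_
        filter_upwards [Lp.coeFn_smul c φ] with t ht
        rw [ht]; simp [mul_assoc] } K (by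
    intro φ
    refine (norm_integral_le_integral_norm _).trans ?_
    rw [L1.norm_eq_integral_norm, mul_comm, ← integral_mul_const]
    refine integral_mono (pair_integrable φ hg hK).norm
      ((L1.integrable_coeFn φ).norm.mul_const K) fun t => ?_
    simp only [norm_mul]
    exact mul_le_mul_of_nonneg_left (hK _) (norm_nonneg _))

lemma pairL_apply (g : ℝ → ℂ) (K : ℝ) (hg : Continuous g) (hK : ∀ t, ‖g t‖ ≤ K)
    (φ : Lp ℂ 1 muplus) : pairL g K hg hK φ = ∫ t, (φ : ℝ → ℂ) t * g t ∂muplus := rfl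

lemma pair_bound (φ : Lp ℂ 1 muplus) {g : ℝ → ℂ} (hg : Continuous g) {K : ℝ}
    (hK : ∀ t, ‖g t‖ ≤ K) : ‖∫ t, (φ : ℝ → ℂ) t * g t ∂muplus‖ ≤ K * ‖φ‖ := by
  rw [← pairL_apply g K hg hK]
  refine ContinuousLinearMap.le_of_opNorm_le _ ?_ _
  exact LinearMap.mkContinuous_norm_le _ ((norm_nonneg _).trans (hK 0)) _

lemma hankel_shift {T : Lp ℂ 1 muplus →L[ℂ] Lp ℂ 1 muplus} (hT : IsHankelianLp 1 ∞ T)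
    {g : ℝ → ℂ} (hg : Continuous g) {K : ℝ} (hK : ∀ t, ‖g t‖ ≤ K) (hg0 : ∀ t ≤ 0, g t = 0)
    {v : ℝ} (hv : 0 ≤ v) (f fv : Lp ℂ 1 muplus)
    (hfv : (fv : ℝ → ℂ) =ᵐ[muplus] shiftR v (f : ℝ → ℂ)) :
    ∫ t, (T fv : ℝ → ℂ) t * g t ∂muplus = ∫ t, (T f : ℝ → ℂ) t * g (t - v) ∂muplus := by
  rcases hv.eq_or_lt with rfl | hv
  · have : fv = f := by
      apply Lp.ext
      filter_upwards [hfv, ae_pos] with t h1 h2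
      rw [h1]; simp [shiftR, h2]
    simp [this]
  · have hgm : MemLp g ∞ muplus :=
      memLp_top_of_bound hg.aestronglyMeasurable K (Filter.Eventually.of_forall hK)
    have hg' : Continuous fun t => g (t - v) := by fun_prop
    have hgvm : MemLp (fun t => g (t - v)) ∞ muplus :=
      memLp_top_of_bound hg'.aestronglyMeasurable K (Filter.Eventually.of_forall fun t => hK _)
    have key := hT v hv f fv hgm.toLp hgvm.toLp hfv (by
      have hsh : ∀ᵐ t ∂muplus, v < t → (hgm.toLp : ℝ → ℂ) (t - v) = g (t - v) := by
        have h1 : ∀ᵐ t : ℝ, t ∈ Set.Ioi (0:ℝ) → (hgm.toLp : ℝ → ℂ) t = g t := by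
          have := hgm.coeFn_toLp
          unfold muplus at this
          exact (ae_restrict_iff' measurableSet_Ioi).1 this
        have h2 := (measurePreserving_sub_right volume v).quasiMeasurePreserving.ae h1
        unfold muplus
        refine ae_restrict_of_ae ?_
        filter_upwards [h2] with t ht hvt
        exact ht (by simpa using hvt)
      filter_upwards [hsh, hgvm.coeFn_toLp] with t h1 h2
      rw [h2]
      simp only [shiftR]
      split_ifs with h
      · exact (h1 h).symm
      · exact hg0 _ (by linarith))
    have e1 : ∫ t, (T fv : ℝ → ℂ) t * (hgm.toLp : ℝ → ℂ) t ∂muplus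
        = ∫ t, (T fv : ℝ → ℂ) t * g t ∂muplus := by
      refine integral_congr_ae ?_
      filter_upwards [hgm.coeFn_toLp] with t ht
      rw [ht]
    have e2 : ∫ t, (T f : ℝ → ℂ) t * (hgvm.toLp : ℝ → ℂ) t ∂muplus
        = ∫ t, (T f : ℝ → ℂ) t * g (t - v) ∂muplus := by
      refine integral_congr_ae ?_
      filter_upwards [hgvm.coeFn_toLp] with t ht
      rw [ht]
    rw [← e1, ← e2]
    exact key

lemma muplus_Ioc_lt (a b : ℝ) : muplus (Set.Ioc a b) ≠ ∞ := by
  unfold muplus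
  exact ((Measure.restrict_apply_le _ _).trans_lt (by simp)).ne

/-- indicator of an interval -/
noncomputable def blk (a b : ℝ) : Lp ℂ 1 muplus :=
  indicatorConstLp 1 (measurableSet_Ioc (a := a) (b := b)) (muplus_Ioc_lt a b) (1 : ℂ)

lemma blk_coe (a b : ℝ) : (blk a b : ℝ → ℂ) =ᵐ[muplus] (Set.Ioc a b).indicator fun _ => 1 :=
  indicatorConstLp_coeFn

lemma blk_norm (b : ℝ) (hb : 0 ≤ b) : ‖blk 0 b‖ = b := by
  unfold blk
  rw [norm_indicatorConstLp (by norm_num) (by norm_num)]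
  have : muplus.real (Set.Ioc 0 b) = b := by
    unfold muplus
    rw [measureReal_restrict_apply measurableSet_Ioc,
      Set.inter_eq_left.2 Set.Ioc_subset_Ioi_self, Real.volume_real_Ioc_of_le hb, sub_zero]
  rw [this]; simp

lemma blk_shift {v d : ℝ} (hv : 0 ≤ v) :
    (blk v (v + d) : ℝ → ℂ) =ᵐ[muplus] shiftR v (blk 0 d : ℝ → ℂ) := by
  have hsh : ∀ᵐ t ∂muplus, v < t → (blk 0 d : ℝ → ℂ) (t - v) =
      (Set.Ioc 0 d).indicator (fun _ => 1) (t - v) := by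
    have h1 : ∀ᵐ t : ℝ, t ∈ Set.Ioi (0:ℝ) → (blk 0 d : ℝ → ℂ) t =
        (Set.Ioc 0 d).indicator (fun _ => 1) t := by
      have := blk_coe 0 d
      exact (ae_restrict_iff' measurableSet_Ioi).1 this
    have h2 := (measurePreserving_sub_right volume v).quasiMeasurePreserving.ae h1
    refine ae_restrict_of_ae ?_
    filter_upwards [h2] with t ht hvt
    exact ht (by simpa using hvt)
  filter_upwards [hsh, blk_coe v (v + d)] with t h1 h2
  rw [h2]
  simp only [shiftR]
  split_ifs with h
  · rw [h1 h]
    simp only [Set.indicator, Set.mem_Ioc]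
    congr 1
    apply propext
    constructor <;> rintro ⟨h1, h2⟩ <;> constructor <;> linarith
  · simp [Set.indicator, h]

/-- approximate identity -/
noncomputable def apx (n : ℕ) : Lp ℂ 1 muplus := ((n : ℂ) + 1) • blk 0 (1 / ((n : ℝ) + 1))

lemma apx_norm (n : ℕ) : ‖apx n‖ = 1 := by
  unfold apx
  have h : (0:ℝ) < (n : ℝ) + 1 := by positivity
  rw [norm_smul, blk_norm _ (by positivity)]
  have : ‖(n : ℂ) + 1‖ = (n : ℝ) + 1 := by
    have : ((n : ℂ) + 1) = (((n : ℝ) + 1 : ℝ) : ℂ) := by push_cast; rfl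
    rw [this, Complex.norm_real, Real.norm_of_nonneg h.le]
  rw [this]
  field_simp

/-- Riemann sums for the convolution. -/
lemma riemann_cv {f g : ℝ → ℂ} (hf : Continuous f) (hg : Continuous g) (N : ℕ)
    (hfN : ∀ t, (N : ℝ) ≤ t → f t = 0) (m : ℕ) (hm : 0 < m) (η : ℝ)
    (hη : ∀ u x y : ℝ, |x - y| ≤ 1 / m → ‖f x * g (u - x) - f y * g (u - y)‖ ≤ η) (u : ℝ) :
    ‖cv f g u - ∑ k ∈ Finset.range (N * m), (1 / (m : ℂ)) * f (k / m) * g (u - k / m)‖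
      ≤ N * η := by
  have hm' : (0:ℝ) < m := by exact_mod_cast hm
  let a : ℕ → ℝ := fun k => k / m
  have hF : Continuous fun v => f v * g (u - v) := by fun_prop
  have haN : a (N * m) = N := by simp only [a]; push_cast; field_simp
  have ha0 : a 0 = 0 := by simp [a]
  have ha1 : ∀ k, a (k + 1) - a k = 1 / m := by intro k; simp only [a]; push_cast; ring
  have h1 : cv f g u = ∫ v in (0:ℝ)..N, f v * g (u - v) := by
    unfold cv muplus
    rw [intervalIntegral.integral_of_le (Nat.cast_nonneg N)]
    refine setIntegral_eq_of_subset_of_forall_diff_eq_zero measurableSet_Ioi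
      Set.Ioc_subset_Ioi_self ?_
    rintro t ⟨h1, h2⟩
    rw [hfN t, zero_mul]
    by_contra h
    exact h2 ⟨h1, by linarith⟩
  have h2 : cv f g u = ∑ k ∈ Finset.range (N * m), ∫ v in a k..a (k + 1), f v * g (u - v) := by
    rw [intervalIntegral.sum_integral_adjacent_intervals
      (fun k _ => hF.intervalIntegrable _ _), h1, haN, ha0]
  rw [h2, ← Finset.sum_sub_distrib]
  refine (norm_sum_le _ _).trans ?_
  have h3 : ∀ k ∈ Finset.range (N * m), ‖(∫ v in a k..a (k + 1), f v * g (u - v)) -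
      (1 / (m : ℂ)) * f (k / m) * g (u - k / m)‖ ≤ η * (1 / m) := by
    intro k _
    have e : (1 / (m : ℂ)) * f (k / m) * g (u - k / m) =
        ∫ v in a k..a (k + 1), f (a k) * g (u - a k) := by
      rw [intervalIntegral.integral_const, ha1]
      simp only [a, Complex.real_smul]
      push_cast
      ring
    rw [e, ← intervalIntegral.integral_sub (hF.intervalIntegrable _ _) (by simp)]
    have := intervalIntegral.norm_integral_le_of_norm_le_const (a := a k) (b := a (k + 1))
      (f := fun v => f v * g (u - v) - f (a k) * g (u - a k)) (C := η) (by
        intro x hx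
        rw [Set.uIoc_of_le (by have := ha1 k; have : 0 < 1 / (m:ℝ) := by positivity
                               linarith)] at hx
        refine hη u x (a k) ?_
        rw [← ha1 k, abs_of_nonneg (by linarith [hx.1])]
        linarith [hx.2])
    rwa [ha1, abs_of_pos (by positivity)] at this
  refine (Finset.sum_le_sum h3).trans (le_of_eq ?_)
  simp
  field_simp

/-- step function approximation in `L¹`. -/
lemma step_norm {f : ℝ → ℂ} (F : Lp ℂ 1 muplus) (hF : (F : ℝ → ℂ) =ᵐ[muplus] f) (N : ℕ)
    (hfN : ∀ t, (N : ℝ) ≤ t → f t = 0) (m : ℕ) (hm : 0 < m) (η : ℝ) (hη0 : 0 ≤ η)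
    (hη : ∀ x y : ℝ, |x - y| ≤ 1 / m → ‖f x - f y‖ ≤ η) :
    ‖F - ∑ k ∈ Finset.range (N * m), f (k / m) • blk (k / m) (k / m + 1 / m)‖ ≤ N * η := by
  have hm' : (0:ℝ) < m := by exact_mod_cast hm
  rw [L1.norm_eq_integral_norm]
  have hN : ∫ t, (Set.Ioc (0:ℝ) N).indicator (fun _ => η) t ∂muplus = N * η := by
    rw [integral_indicator measurableSet_Ioc, integral_const]
    unfold muplus
    rw [measureReal_restrict_apply MeasurableSet.univ]
    simp only [Set.univ_inter]
    rw [measureReal_restrict_apply measurableSet_Ioc]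
    rw [Set.inter_eq_left.2 Set.Ioc_subset_Ioi_self, Real.volume_real_Ioc_of_le (by positivity)]
    simp
  rw [← hN]
  have hall : ∀ᵐ t ∂muplus, ∀ k : ℕ, (f (k / m) • blk (k / m) (k / m + 1 / m) : Lp ℂ 1 muplus) t
      = f (k / m) * (Set.Ioc (k / m : ℝ) (k / m + 1 / m)).indicator (fun _ => (1:ℂ)) t := by
    rw [ae_all_iff]
    intro k
    filter_upwards [Lp.coeFn_smul (f (k / m)) (blk (k / m) (k / m + 1 / m)),
      blk_coe (k / m) (k / m + 1 / m)] with t h1 h2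
    rw [h1, Pi.smul_apply, h2, smul_eq_mul]
  refine integral_mono_of_nonneg (Filter.Eventually.of_forall fun t => norm_nonneg _) ?_ ?_
  · rw [integrable_indicator_iff measurableSet_Ioc]
    exact integrableOn_const (muplus_Ioc_lt _ _)
  · filter_upwards [hF, ae_pos, hall, Lp.coeFn_sub F
      (∑ k ∈ Finset.range (N * m), f (k / m) • blk (k / m) (k / m + 1 / m)),
      Lp.coeFn_finsetSum (Finset.range (N * m))
        (fun k : ℕ => (f (k / m) • blk (k / m) (k / m + 1 / m) : Lp ℂ 1 muplus))]
      with t h1 h2 h3 h4 h5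
    rw [h4, Pi.sub_apply, h1, h5, Finset.sum_apply]
    rw [Finset.sum_congr rfl fun k _ => h3 k]
    by_cases ht : t ≤ N
    · rw [Set.indicator_of_mem (show t ∈ Set.Ioc (0:ℝ) N from ⟨h2, ht⟩)]
      obtain ⟨j, hj⟩ : ∃ j : ℕ, ⌈t * m⌉₊ = j + 1 :=
        Nat.exists_eq_succ_of_ne_zero (Nat.ceil_pos.2 (by positivity)).ne'
      have hj1 : (j : ℝ) < t * m := by
        have : j < ⌈t * m⌉₊ := by omega
        exact Nat.lt_ceil.1 this
      have hj2 : t * m ≤ j + 1 := by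
        have := Nat.le_ceil (t * m)
        rw [hj] at this
        exact_mod_cast this
      have hjN : j < N * m := by
        have : (j : ℝ) < N * m := hj1.trans_le (mul_le_mul_of_nonneg_right ht hm'.le)
        exact_mod_cast this
      have hk : ∀ k : ℕ, t ∈ Set.Ioc (k / m : ℝ) (k / m + 1 / m) ↔ k = j := by
        intro k
        rw [← add_div, Set.mem_Ioc, div_lt_iff₀ hm', le_div_iff₀ hm']
        constructor
        · rintro ⟨h6, h7⟩
          have a1 : (k : ℝ) < j + 1 := h6.trans_le hj2
          have a2 : (j : ℝ) < k + 1 := hj1.trans_le h7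
          have a3 : k < j + 1 := by exact_mod_cast a1
          have a4 : j < k + 1 := by exact_mod_cast a2
          omega
        · rintro rfl
          exact ⟨hj1, hj2⟩
      rw [Finset.sum_eq_single j]
      · rw [Set.indicator_of_mem ((hk j).2 rfl), mul_one]
        refine hη _ _ ?_
        have := (hk j).2 rfl
        rw [abs_of_nonneg (by linarith [this.1])]
        linarith [this.2]
      · intro k _ hkj
        rw [Set.indicator_of_notMem (by rw [hk]; exact hkj), mul_zero]
      · intro h; exact absurd (Finset.mem_range.2 hjN) h
    · rw [hfN t (by linarith), Finset.sum_eq_zero]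
      · rw [Set.indicator_of_notMem (by simp [ht])]; simp
      · intro k hk
        rw [Set.indicator_of_notMem, mul_zero]
        rintro ⟨-, h7⟩
        apply ht
        refine h7.trans ?_
        rw [← add_div, div_le_iff₀ hm']
        have := Finset.mem_range.1 hk
        exact_mod_cast this

lemma exists_nat_bound {f : ℝ → ℂ} (hf : HasCompactSupport f) :
    ∃ N : ℕ, ∀ t, (N : ℝ) ≤ t → f t = 0 := by
  obtain ⟨M, hM⟩ := hf.isCompact.bddAbove
  obtain ⟨N, hN⟩ := exists_nat_gt M
  refine ⟨N, fun t ht => image_eq_zero_of_notMem_tsupport fun h => ?_⟩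
  have := hM h
  linarith

lemma cv_zero {f g : ℝ → ℂ} (hg0 : ∀ t ≤ 0, g t = 0) (u : ℝ) (hu : u ≤ 0) : cv f g u = 0 := by
  unfold cv
  rw [integral_eq_zero_of_ae]
  filter_upwards [ae_pos] with v hv
  rw [hg0 _ (by linarith)]; simp

lemma cv_compact {f g : ℝ → ℂ} (hf : HasCompactSupport f) (hg : HasCompactSupport g)
    (hg0 : ∀ t ≤ 0, g t = 0) : HasCompactSupport (cv f g) := by
  obtain ⟨N, hN⟩ := exists_nat_bound hf
  obtain ⟨M, hM⟩ := exists_nat_bound hg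
  refine HasCompactSupport.intro (isCompact_Icc (a := (0:ℝ)) (b := N + M)) fun u hu => ?_
  by_cases h : u ≤ 0
  · exact cv_zero hg0 u h
  have h2 : (N : ℝ) + M < u := by
    by_contra h'
    exact hu ⟨by linarith, by linarith⟩
  unfold cv
  rw [integral_eq_zero_of_ae]
  refine Filter.Eventually.of_forall fun v => ?_
  by_cases hv : (N : ℝ) ≤ v
  · simp [hN v hv]
  · simp [hM (u - v) (by linarith)]

lemma riemann_limit {T : Lp ℂ 1 muplus →L[ℂ] Lp ℂ 1 muplus} (hT : IsHankelianLp 1 ∞ T)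
    {f g : ℝ → ℂ} (hf : Continuous f) (hfs : HasCompactSupport f)
    (hg : Continuous g) (hgs : HasCompactSupport g) (hg0 : ∀ t ≤ 0, g t = 0)
    (F : Lp ℂ 1 muplus) (hF : (F : ℝ → ℂ) =ᵐ[muplus] f) :
    Filter.Tendsto (fun n => ∫ t, (T (apx n) : ℝ → ℂ) t * cv f g t ∂muplus) Filter.atTop
      (nhds (∫ t, (T F : ℝ → ℂ) t * g t ∂muplus)) := by
  obtain ⟨N, hN⟩ := exists_nat_bound hfs
  obtain ⟨Kf, hKf⟩ := hf.bounded_above_of_compact_support hfs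
  obtain ⟨K, hK⟩ := hg.bounded_above_of_compact_support hgs
  have hKf0 : 0 ≤ Kf := (norm_nonneg _).trans (hKf 0)
  have hK0 : 0 ≤ K := (norm_nonneg _).trans (hK 0)
  have hfi : Integrable f muplus := hf.integrable_of_hasCompactSupport hfs
  have huf := Metric.uniformContinuous_iff.1 (hfs.uniformContinuous_of_continuous hf)
  have hug := Metric.uniformContinuous_iff.1 (hgs.uniformContinuous_of_continuous hg)
  rw [Metric.tendsto_atTop]
  intro ε hε
  let A : ℝ := N * ‖T‖ * (2 * K + Kf) + 1
  have hA : 0 < A := by positivity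
  let η : ℝ := ε / 2 / A
  have hη : 0 < η := by positivity
  obtain ⟨δ1, hδ1, h1⟩ := huf η hη
  obtain ⟨δ2, hδ2, h2⟩ := hug η hη
  obtain ⟨n0, hn0⟩ := exists_nat_one_div_lt (lt_min hδ1 hδ2)
  refine ⟨n0, fun n hn => ?_⟩
  set m : ℕ := n + 1 with hm
  have hmpos : 0 < m := by omega
  have hm' : (0:ℝ) < m := by exact_mod_cast hmpos
  have hmδ : 1 / (m : ℝ) < min δ1 δ2 := by
    refine lt_of_le_of_lt ?_ hn0
    apply one_div_le_one_div_of_le (by positivity)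
    rw [hm]; push_cast
    have : (n0 : ℝ) ≤ n := by exact_mod_cast hn
    linarith
  have hf1 : ∀ x y : ℝ, |x - y| ≤ 1 / m → ‖f x - f y‖ ≤ η := by
    intro x y hxy
    have := h1 (a := x) (b := y) (by
      rw [Real.dist_eq]; exact hxy.trans_lt (hmδ.trans_le (min_le_left _ _)))
    rw [dist_eq_norm] at this
    exact this.le
  have hg1 : ∀ x y : ℝ, |x - y| ≤ 1 / m → ‖g x - g y‖ ≤ η := by
    intro x y hxy
    have := h2 (a := x) (b := y) (by
      rw [Real.dist_eq]; exact hxy.trans_lt (hmδ.trans_le (min_le_right _ _)))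
    rw [dist_eq_norm] at this
    exact this.le
  have hfg1 : ∀ u x y : ℝ, |x - y| ≤ 1 / m →
      ‖f x * g (u - x) - f y * g (u - y)‖ ≤ η * K + Kf * η := by
    intro u x y hxy
    have e : f x * g (u - x) - f y * g (u - y) =
        (f x - f y) * g (u - x) + f y * (g (u - x) - g (u - y)) := by ring
    rw [e]
    refine (norm_add_le _ _).trans (add_le_add ?_ ?_)
    · rw [norm_mul]
      exact mul_le_mul (hf1 x y hxy) (hK _) (norm_nonneg _) hη.le
    · rw [norm_mul]
      refine mul_le_mul (hKf y) (hg1 _ _ ?_) (norm_nonneg _) hKf0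
      rw [show u - x - (u - y) = -(x - y) by ring, abs_neg]
      exact hxy
  let S : Lp ℂ 1 muplus := ∑ k ∈ Finset.range (N * m), f (k / m) • blk (k / m) (k / m + 1 / m)
  let r : ℝ → ℂ := fun u =>
    ∑ k ∈ Finset.range (N * m), (1 / (m : ℂ)) * f (k / m) * g (u - k / m)
  have hrc : Continuous r := by
    simp only [r]
    fun_prop
  have hS : ‖F - S‖ ≤ N * η := step_norm F hF N hN m hmpos η hη.le hf1
  have hr : ∀ u, ‖cv f g u - r u‖ ≤ N * (η * K + Kf * η) := fun u =>
    riemann_cv hf hg N hN m hmpos _ hfg1 u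
  have hcvc : Continuous (cv f g) := cv_continuous hfi hg K hK
  have hcvb := cv_bound (g := g) hfi K hK
  -- the key identity
  have key : ∫ t, (T S : ℝ → ℂ) t * g t ∂muplus = ∫ t, (T (apx n) : ℝ → ℂ) t * r t ∂muplus := by
    rw [← pairL_apply g K hg hK]
    simp only [S, map_sum, map_smul, smul_eq_mul]
    have e : ∀ t, (T (apx n) : ℝ → ℂ) t * r t = ∑ k ∈ Finset.range (N * m),
        ((1 / (m : ℂ)) * f (k / m)) * ((T (apx n) : ℝ → ℂ) t * g (t - k / m)) := by
      intro t
      simp only [r, Finset.mul_sum]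
      refine Finset.sum_congr rfl fun k _ => by ring
    simp only [e]
    have hi : ∀ k : ℕ, Integrable (fun t => (T (apx n) : ℝ → ℂ) t * g (t - k / m)) muplus :=
      fun k => pair_integrable _ (by fun_prop) (fun t => hK _)
    rw [integral_finsetSum _ fun k _ => (hi k).const_mul _]
    refine Finset.sum_congr rfl fun k _ => ?_
    rw [integral_const_mul, pairL_apply]
    rw [hankel_shift hT hg hK hg0 (v := k / m) (by positivity) (blk 0 (1 / m)) _
      (blk_shift (by positivity))]
    have hg' : Continuous fun t => g (t - k / m) := by fun_prop
    have hK' : ∀ t, ‖g (t - k / m)‖ ≤ K := fun t => hK _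
    rw [← pairL_apply _ K hg' hK', ← pairL_apply _ K hg' hK']
    have : apx n = (m : ℂ) • blk 0 (1 / m) := by
      simp only [apx, hm]; push_cast; rfl
    rw [this, map_smul, map_smul, smul_eq_mul]
    have : (m : ℂ) ≠ 0 := by exact_mod_cast hmpos.ne'
    field_simp
  have hrb : ∀ u, ‖r u‖ ≤ N * (η * K + Kf * η) + (∫ t, ‖f t‖ ∂muplus) * K := by
    intro u
    have e : r u = -(cv f g u - r u) + cv f g u := by ring
    rw [e]
    refine (norm_add_le _ _).trans (add_le_add ?_ (hcvb u))
    rw [norm_neg]; exact hr u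
  have e1 : (∫ t, (T (apx n) : ℝ → ℂ) t * cv f g t ∂muplus) -
      ∫ t, (T F : ℝ → ℂ) t * g t ∂muplus =
      (∫ t, (T (apx n) : ℝ → ℂ) t * (cv f g t - r t) ∂muplus) -
      ∫ t, (T (F - S) : ℝ → ℂ) t * g t ∂muplus := by
    have a1 : ∫ t, (T (apx n) : ℝ → ℂ) t * (cv f g t - r t) ∂muplus =
        (∫ t, (T (apx n) : ℝ → ℂ) t * cv f g t ∂muplus) -
          ∫ t, (T (apx n) : ℝ → ℂ) t * r t ∂muplus := by
      rw [← integral_sub (pair_integrable _ hcvc hcvb) (pair_integrable _ hrc hrb)]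
      congr 1; ext t; ring
    have a2 : ∫ t, (T (F - S) : ℝ → ℂ) t * g t ∂muplus =
        (∫ t, (T F : ℝ → ℂ) t * g t ∂muplus) - ∫ t, (T S : ℝ → ℂ) t * g t ∂muplus := by
      simp only [← pairL_apply g K hg hK, map_sub]
    rw [a1, a2, key]; ring
  rw [dist_eq_norm, e1]
  refine (norm_sub_le _ _).trans_lt ?_
  have b1 := pair_bound (T (apx n)) (hcvc.sub hrc) hr
  have b2 := pair_bound (T (F - S)) hg hK
  have b3 : ‖T (apx n)‖ ≤ ‖T‖ := by
    have := T.le_opNorm (apx n)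
    rwa [apx_norm, mul_one] at this
  have b4 : ‖T (F - S)‖ ≤ ‖T‖ * (N * η) :=
    (T.le_opNorm _).trans (mul_le_mul_of_nonneg_left hS (norm_nonneg _))
  have b5 : N * (η * K + Kf * η) * ‖T (apx n)‖ ≤ N * (η * K + Kf * η) * ‖T‖ :=
    mul_le_mul_of_nonneg_left b3 (by positivity)
  have b6 : K * ‖T (F - S)‖ ≤ K * (‖T‖ * (N * η)) := mul_le_mul_of_nonneg_left b4 hK0
  have b7 : N * (η * K + Kf * η) * ‖T‖ + K * (‖T‖ * (N * η)) + η = η * A := by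
    simp only [A]; ring
  have b8 : η * A = ε / 2 := by simp only [η]; field_simp
  have b9 := b1.trans b5
  have b10 := b2.trans b6
  simp only [Pi.sub_apply] at b9
  linarith

lemma cvh_integrable {ρ : Measure ℝ} {h : ℝ → ℂ} (hh : Integrable h ρ)
    {f g : ℝ → ℂ} (hf : Integrable f muplus) (hg : Continuous g) {K : ℝ}
    (hK : ∀ t, ‖g t‖ ≤ K) : Integrable (fun u => cv f g u * h u) ρ :=
  hh.bdd_mul (c := (∫ t, ‖f t‖ ∂muplus) * K) (cv_continuous hf hg K hK).aestronglyMeasurable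
    (Filter.Eventually.of_forall (cv_bound hf K hK))

lemma cvh_bound {ρ : Measure ℝ} {h : ℝ → ℂ} (hh : Integrable h ρ)
    {f g : ℝ → ℂ} (hf : Integrable f muplus) (hg : Continuous g) {K : ℝ}
    (hK : ∀ t, ‖g t‖ ≤ K) :
    ‖∫ u, cv f g u * h u ∂ρ‖ ≤ (∫ t, ‖f t‖ ∂muplus) * K * ∫ u, ‖h u‖ ∂ρ := by
  refine (norm_integral_le_integral_norm _).trans ?_
  rw [← integral_const_mul]
  refine integral_mono (cvh_integrable hh hf hg hK).norm (hh.norm.const_mul _) fun u => ?_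
  simp only [norm_mul]
  exact mul_le_mul_of_nonneg_right (cv_bound hf K hK u) (norm_nonneg _)

/-- Extension of the representation formula from nice functions. -/
lemma rep_extend (T : Lp ℂ 1 muplus →L[ℂ] Lp ℂ 1 muplus) (ρ : Measure ℝ) (h : ℝ → ℂ)
    (hh : Integrable h ρ)
    (hrep : ∀ (f g : ℝ → ℂ) (F : Lp ℂ 1 muplus), Continuous f → HasCompactSupport f →
      Continuous g → HasCompactSupport g → (∀ t ≤ 0, g t = 0) → (F : ℝ → ℂ) =ᵐ[muplus] f →
      ∫ t, (T F : ℝ → ℂ) t * g t ∂muplus = ∫ u, cv f g u * h u ∂ρ)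
    (F : Lp ℂ 1 muplus) (g : ℝ → ℂ) (hg : Continuous g)
    (hlim : Filter.Tendsto g Filter.atTop (nhds 0)) (hg0 : ∀ t ≤ 0, g t = 0) :
    ∫ t, (T F : ℝ → ℂ) t * g t ∂muplus = ∫ u, cv F g u * h u ∂ρ := by
  have hFi : Integrable (F : ℝ → ℂ) muplus := L1.integrable_coeFn F
  set H : ℝ := ∫ u, ‖h u‖ ∂ρ with hH
  have hH0 : 0 ≤ H := integral_nonneg fun _ => norm_nonneg _
  -- first stage
  have st1 : ∀ g : ℝ → ℂ, Continuous g → HasCompactSupport g → (∀ t ≤ 0, g t = 0) →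
      ∫ t, (T F : ℝ → ℂ) t * g t ∂muplus = ∫ u, cv F g u * h u ∂ρ := by
    intro g hg hgs hg0
    obtain ⟨K, hK⟩ := hg.bounded_above_of_compact_support hgs
    have hK0 : 0 ≤ K := (norm_nonneg _).trans (hK 0)
    rw [← sub_eq_zero, ← norm_le_zero_iff]
    apply le_of_forall_pos_le_add
    intro ε hε
    let A : ℝ := K * ‖T‖ + K * H + 1
    have hA : 0 < A := by positivity
    obtain ⟨f, hfs, hfε, hfc, hfi⟩ :=
      hFi.exists_hasCompactSupport_integral_sub_le (ε := ε / A) (by positivity)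
    have hfm : MemLp f 1 muplus := memLp_one_iff_integrable.2 hfi
    have e0 := hrep f g hfm.toLp hfc hfs hg hgs hg0 hfm.coeFn_toLp
    have e1 : ∫ t, (T F : ℝ → ℂ) t * g t ∂muplus - ∫ t, (T hfm.toLp : ℝ → ℂ) t * g t ∂muplus
        = ∫ t, (T (F - hfm.toLp) : ℝ → ℂ) t * g t ∂muplus := by
      simp only [← pairL_apply g K hg hK, map_sub]
    have hsub : Integrable (fun t => (F : ℝ → ℂ) t - f t) muplus := hFi.sub hfi
    have e2 : ∫ u, cv F g u * h u ∂ρ - ∫ u, cv f g u * h u ∂ρ =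
        ∫ u, cv (fun t => (F : ℝ → ℂ) t - f t) g u * h u ∂ρ := by
      rw [← integral_sub (cvh_integrable hh hFi hg hK) (cvh_integrable hh hfi hg hK)]
      congr 1; ext u
      rw [← sub_mul]
      congr 1
      unfold cv
      rw [← integral_sub (cv_integrable hFi hg K hK u) (cv_integrable hfi hg K hK u)]
      congr 1; ext v; ring
    have e3 : ∫ t, (T F : ℝ → ℂ) t * g t ∂muplus - ∫ u, cv F g u * h u ∂ρ =
        ∫ t, (T (F - hfm.toLp) : ℝ → ℂ) t * g t ∂muplus -
        ∫ u, cv (fun t => (F : ℝ → ℂ) t - f t) g u * h u ∂ρ := by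
      rw [← e1, ← e2, e0]; ring
    have hnorm : ‖F - hfm.toLp‖ ≤ ε / A := by
      rw [L1.norm_eq_integral_norm]
      refine (le_of_eq (integral_congr_ae ?_)).trans hfε
      filter_upwards [Lp.coeFn_sub F hfm.toLp, hfm.coeFn_toLp] with t h1 h2
      rw [h1, Pi.sub_apply, h2]
    rw [e3]
    refine (norm_sub_le _ _).trans ?_
    have b1 := pair_bound (T (F - hfm.toLp)) hg hK
    have b2 := cvh_bound hh hsub hg hK
    have b3 : K * ‖T (F - hfm.toLp)‖ ≤ K * (‖T‖ * (ε / A)) :=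
      mul_le_mul_of_nonneg_left ((T.le_opNorm _).trans
        (mul_le_mul_of_nonneg_left hnorm (norm_nonneg _))) hK0
    have b4 : (∫ t, ‖(F : ℝ → ℂ) t - f t‖ ∂muplus) * K * H ≤ ε / A * K * H := by gcongr
    have b5 : ε / A * A = ε := by field_simp
    have b6 : K * (‖T‖ * (ε / A)) + ε / A * K * H + ε / A = ε / A * A := by
      simp only [A]; ring
    have : 0 < ε / A := by positivity
    linarith
  -- second stage
  rw [← sub_eq_zero, ← norm_le_zero_iff]
  apply le_of_forall_pos_le_add
  intro ε hε
  let A : ℝ := ‖T F‖ + ‖F‖ * H + 1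
  have hA : 0 < A := by positivity
  set η := ε / A with hηdef
  have hη : 0 < η := by positivity
  obtain ⟨M, hM⟩ := Filter.eventually_atTop.1 ((Metric.tendsto_nhds.1 hlim) η hη)
  let χ : ℝ → ℝ := fun t => max 0 (min 1 (M + 1 - t))
  have hχ0 : ∀ t, 0 ≤ χ t := fun t => le_max_left _ _
  have hχ1 : ∀ t, χ t ≤ 1 := fun t => max_le zero_le_one (min_le_left _ _)
  let g' : ℝ → ℂ := fun t => g t * (χ t : ℂ)
  have hg'c : Continuous g' := by simp only [g', χ]; fun_prop
  have hg'0 : ∀ t ≤ 0, g' t = 0 := fun t ht => by simp [g', hg0 t ht]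
  have hg's : HasCompactSupport g' := by
    refine HasCompactSupport.intro (isCompact_Icc (a := (0:ℝ)) (b := M + 1)) fun u hu => ?_
    by_cases h : u ≤ 0
    · exact hg'0 u h
    have h2 : M + 1 < u := by
      by_contra h'
      exact hu ⟨by linarith, by linarith⟩
    have : χ u = 0 := by
      simp only [χ]
      rw [max_eq_left]
      exact (min_le_right _ _).trans (by linarith)
    simp [g', this]
  have hdiff : ∀ t, ‖g t - g' t‖ ≤ η := by
    intro t
    have e : g t - g' t = g t * ((1 - χ t : ℝ) : ℂ) := by simp only [g']; push_cast; ring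
    rw [e, norm_mul, Complex.norm_real, Real.norm_of_nonneg (by linarith [hχ1 t])]
    by_cases ht : M ≤ t
    · have := hM t ht
      rw [dist_zero_right] at this
      calc ‖g t‖ * (1 - χ t) ≤ ‖g t‖ * 1 :=
            mul_le_mul_of_nonneg_left (by linarith [hχ0 t]) (norm_nonneg _)
        _ ≤ η := by linarith
    · have : χ t = 1 := by
        simp only [χ]
        rw [min_eq_left (by linarith)]
        simp
      rw [this]; simp [hη.le]
  obtain ⟨K', hK'⟩ := hg'c.bounded_above_of_compact_support hg's
  have hK : ∀ t, ‖g t‖ ≤ K' + η := by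
    intro t
    have := norm_add_le (g' t) (g t - g' t)
    rw [add_sub_cancel] at this
    linarith [hK' t, hdiff t]
  have hdc : Continuous fun t => g t - g' t := hg.sub hg'c
  have e0 := st1 g' hg'c hg's hg'0
  have e1 : ∫ t, (T F : ℝ → ℂ) t * g t ∂muplus - ∫ t, (T F : ℝ → ℂ) t * g' t ∂muplus
      = ∫ t, (T F : ℝ → ℂ) t * (g t - g' t) ∂muplus := by
    rw [← integral_sub (pair_integrable _ hg hK) (pair_integrable _ hg'c hK')]
    congr 1; ext t; ring
  have e2 : ∫ u, cv F g u * h u ∂ρ - ∫ u, cv F g' u * h u ∂ρ =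
      ∫ u, cv F (fun t => g t - g' t) u * h u ∂ρ := by
    rw [← integral_sub (cvh_integrable hh hFi hg hK) (cvh_integrable hh hFi hg'c hK')]
    congr 1; ext u
    rw [← sub_mul]
    congr 1
    unfold cv
    rw [← integral_sub (cv_integrable hFi hg _ hK u) (cv_integrable hFi hg'c _ hK' u)]
    congr 1; ext v; ring
  have e3 : ∫ t, (T F : ℝ → ℂ) t * g t ∂muplus - ∫ u, cv F g u * h u ∂ρ =
      ∫ t, (T F : ℝ → ℂ) t * (g t - g' t) ∂muplus -
      ∫ u, cv F (fun t => g t - g' t) u * h u ∂ρ := by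
    rw [← e1, ← e2, e0]; ring
  rw [e3]
  refine (norm_sub_le _ _).trans ?_
  have b1 := pair_bound (T F) hdc hdiff
  have b2 := cvh_bound hh hFi hdc hdiff
  rw [← L1.norm_eq_integral_norm] at b2
  have b5 : η * A = ε := by simp only [hηdef]; field_simp
  have b6 : η * ‖T F‖ + ‖F‖ * η * H + η = η * A := by simp only [A]; ring
  linarith

/-- every Hankelian `T ∈ B(L¹(ℝ₊))` is of the form `H_ν` for a bounded
complex Borel measure `ν` on `(0,∞)` — encoded by a finite positive measure `ρ` vanishing
on `(−∞,0]` and a unimodular density `w` (`dν = w dρ`, `‖ν‖ = ρ(univ)`) — with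
`‖ν‖ = ‖T‖` and `⟨T f, g⟩ = ∫ (f ∗ g)(u) dν(u)` for all `f ∈ L¹(ℝ₊)` and `g ∈ C₀((0,∞))`
(extended by `0` outside `(0,∞)`); so `ν ↦ H_ν` is an isometric isomorphism of `M((0,∞))`
onto `Hank₁(ℝ₊)`. -/
theorem hankel_l1_eq_measures (T : Lp ℂ 1 muplus →L[ℂ] Lp ℂ 1 muplus)
    (hT : IsHankelianLp 1 ∞ T) :
    ∃ (ρ : Measure ℝ) (w : ℝ → ℂ),
      IsFiniteMeasure ρ ∧ ρ (Set.Iic 0) = 0 ∧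
      Measurable w ∧ (∀ u : ℝ, ‖w u‖ = 1) ∧
      (ρ Set.univ).toReal = ‖T‖ ∧
      ∀ (f : Lp ℂ 1 muplus) (g : ℝ → ℂ),
        Continuous g → Filter.Tendsto g Filter.atTop (nhds 0) → (∀ t : ℝ, t ≤ 0 → g t = 0) →
        ∫ t, (T f : ℝ → ℂ) t * g t ∂muplus
          = ∫ u, (∫ t in Set.Ioo 0 u, (f : ℝ → ℂ) (u - t) * g t) * w u ∂ρ := by
  have hTn : ∀ n, ‖T (apx n)‖ ≤ ‖T‖ := fun n => by
    have := T.le_opNorm (apx n)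
    rwa [apx_norm, mul_one] at this
  obtain ⟨ρ0, h, hfin, hhm, hhi0, hlim⟩ := weak_limit muplus (fun n => (T (apx n) : ℝ → ℂ))
    (fun n => L1.integrable_coeFn _) ‖T‖ (fun n => by
      rw [← L1.norm_eq_integral_norm]; exact hTn n)
  let ρ1 : Measure ℝ := ρ0.restrict (Set.Ioi 0)
  have hhi : Integrable h ρ1 := hhi0.restrict
  have hρ1 : ρ1 (Set.Iic 0) = 0 := by
    simp only [ρ1]
    rw [Measure.restrict_apply measurableSet_Iic]
    simp [Set.Iic_inter_Ioi]
  have hres : ∀ G : ℝ → ℂ, (∀ t ≤ 0, G t = 0) →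
      ∫ t, G t * h t ∂ρ0 = ∫ t, G t * h t ∂ρ1 := by
    intro G hG
    refine (setIntegral_eq_integral_of_forall_compl_eq_zero fun t ht => ?_).symm
    rw [hG t (by simpa using ht), zero_mul]
  have hrep := rep_extend T ρ1 h hhi (by
    intro f g F hfc hfs hg hgs hg0 hF
    have hfi : Integrable f muplus := hfc.integrable_of_hasCompactSupport hfs
    obtain ⟨K, hK⟩ := hg.bounded_above_of_compact_support hgs
    rw [← hres _ (cv_zero hg0)]
    refine tendsto_nhds_unique ?_
      (hlim (cv f g) (cv_continuous hfi hg K hK) (cv_compact hfs hgs hg0))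
    refine (riemann_limit hT hfc hfs hg hgs hg0 F hF).mono_left ?_
    rw [← Nat.cofinite_eq_atTop]
    exact Filter.hyperfilter_le_cofinite)
  have hup : ∫ t, ‖h t‖ ∂ρ1 ≤ ‖T‖ := by
    refine dual_norm ρ1 hρ1 h hhi _ fun g hg hgs hg0 hg1 => ?_
    have e : ∫ t, h t * g t ∂ρ1 = ∫ t, g t * h t ∂ρ0 := by
      rw [hres g hg0]; congr 1; ext t; ring
    rw [e]
    refine le_of_tendsto (hlim g hg hgs).norm (Filter.Eventually.of_forall fun n => ?_)
    have := pair_bound (T (apx n)) hg hg1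
    rw [one_mul] at this
    exact this.trans (hTn n)
  have hH0 : 0 ≤ ∫ t, ‖h t‖ ∂ρ1 := integral_nonneg fun _ => norm_nonneg _
  have hlow : ‖T‖ ≤ ∫ t, ‖h t‖ ∂ρ1 := by
    refine T.opNorm_le_bound hH0 fun F => ?_
    rw [L1.norm_eq_integral_norm (T F)]
    refine dual_norm muplus muplus_Iic _ (L1.integrable_coeFn _) _ fun g hg hgs hg0 hg1 => ?_
    have hglim : Filter.Tendsto g Filter.atTop (nhds 0) := by
      obtain ⟨N, hN⟩ := exists_nat_bound hgs
      refine tendsto_const_nhds.congr' ?_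
      filter_upwards [Filter.eventually_ge_atTop (N : ℝ)] with t ht
      exact (hN t ht).symm
    rw [hrep F g hg hglim hg0]
    have := cvh_bound hhi (L1.integrable_coeFn F) hg hg1
    rw [← L1.norm_eq_integral_norm, mul_one, mul_comm] at this
    exact this
  have hHm : Measurable fun t => ‖h t‖ₑ := hhm.enorm
  refine ⟨ρ1.withDensity fun t => ‖h t‖ₑ, fun t => if h t = 0 then 1 else h t / ‖h t‖,
    ?_, ?_, ?_, ?_, ?_, ?_⟩
  · exact isFiniteMeasure_withDensity hhi.2.ne
  · exact withDensity_absolutelyContinuous _ _ hρ1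
  · refine Measurable.ite (hhm (measurableSet_singleton 0)) measurable_const ?_
    exact hhm.div (Complex.measurable_ofReal.comp hhm.norm)
  · intro u
    beta_reduce
    split_ifs with hu
    · simp
    · have : ‖h u‖ ≠ 0 := by simpa using hu
      simp [this]
  · rw [withDensity_apply _ MeasurableSet.univ, Measure.restrict_univ,
      ← integral_norm_eq_lintegral_enorm hhi.1]
    exact le_antisymm hup hlow
  · intro f g hg hgl hg0
    rw [hrep f g hg hgl hg0, integral_withDensity_eq_integral_toReal_smul hHm
      (Filter.Eventually.of_forall fun t => enorm_lt_top)]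
    congr 1; ext u
    rw [cv_eq _ _ hg0, toReal_enorm, Complex.real_smul]
    beta_reduce
    split_ifs with hu
    · simp [hu]
    · have : (‖h u‖ : ℂ) ≠ 0 := by simpa using hu
      field_simp
end

section
/- Let T ∈ B(L¹(ℝ₊)) be Hankelian. Then for all h, f ∈ L¹(ℝ₊) and g ∈ C₀((0,∞)), one has ⟨T(h ∗ f), g⟩ = ⟨T h, f ∗ g⟩, where (h ∗ f)(t) = ∫₀^t h(t−s) f(s) ds ∈ L¹(ℝ₊) and (f ∗ g)(t) = ∫₀^t f(s) g(t−s) ds ∈ L^∞(ℝ₊). -/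
open scoped ENNReal
open MeasureTheory

open MeasureTheory

instance muplus_sfinite : SFinite muplus := by unfold muplus; infer_instance

lemma shiftR_eq_indicator (s : ℝ) (b : ℝ → ℂ) (t : ℝ) :
    shiftR s b t = (Set.Ioi (0 : ℝ)).indicator b (t - s) := by
  simp [shiftR, Set.indicator_apply]

lemma integral_Ioo_eq_shift (a b : ℝ → ℂ) (t : ℝ) :
    ∫ s in Set.Ioo 0 t, a s * b (t - s) = ∫ s, a s * shiftR s b t ∂muplus := by
  have h1 : ∀ s, a s * shiftR s b t = (Set.Iio t).indicator (fun s => a s * b (t - s)) s := by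
    intro s
    by_cases h : s < t <;> simp [shiftR, h]
  simp_rw [h1]
  rw [integral_indicator measurableSet_Iio, muplus, Measure.restrict_restrict measurableSet_Iio]
  congr 2
  ext x
  simp [and_comm]

lemma fubini_shift (a b w : ℝ → ℂ)
    (hint : Integrable (fun p : ℝ × ℝ => w p.1 * (a p.2 * shiftR p.2 b p.1))
      (muplus.prod muplus)) :
    ∫ t, w t * (∫ s in Set.Ioo 0 t, a s * b (t - s)) ∂muplus
      = ∫ s, a s * ∫ t, w t * shiftR s b t ∂muplus ∂muplus := by
  simp_rw [integral_Ioo_eq_shift, ← integral_const_mul]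
  rw [integral_integral_swap hint]
  congr 1
  ext s
  congr 1
  ext t
  ring

/-- Pairing with a bounded measurable function. -/
lemma exists_pairing (w : ℝ → ℂ) (hw : Measurable w) (C : ℝ) (hC : ∀ t, ‖w t‖ ≤ C) :
    ∃ P : Lp ℂ 1 muplus →L[ℂ] ℂ, ∀ k : Lp ℂ 1 muplus,
      P k = ∫ t, (k : ℝ → ℂ) t * w t ∂muplus := by
  have hI : ∀ k : Lp ℂ 1 muplus, Integrable (fun t => (k : ℝ → ℂ) t * w t) muplus := fun k =>
    (L1.integrable_coeFn k).mul_bdd (c := C) hw.aestronglyMeasurable (ae_of_all _ hC)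
  refine ⟨LinearMap.mkContinuous
    { toFun := fun k => ∫ t, (k : ℝ → ℂ) t * w t ∂muplus
      map_add' := fun k l => ?_
      map_smul' := fun c k => ?_ } C ?_, fun k => rfl⟩
  · rw [← integral_add (hI k) (hI l)]
    apply integral_congr_ae
    filter_upwards [Lp.coeFn_add k l] with t ht
    rw [ht, Pi.add_apply, add_mul]
  · rw [RingHom.id_apply, smul_eq_mul, ← integral_const_mul]
    apply integral_congr_ae
    filter_upwards [Lp.coeFn_smul c k] with t ht
    rw [ht, Pi.smul_apply, smul_eq_mul, mul_assoc]
  · intro k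
    change ‖∫ t, (k : ℝ → ℂ) t * w t ∂muplus‖ ≤ C * ‖k‖
    rw [L1.norm_eq_integral_norm, ← integral_const_mul]
    apply norm_integral_le_of_norm_le ((L1.integrable_coeFn k).norm.const_mul C)
    refine ae_of_all _ fun t => ?_
    rw [norm_mul, mul_comm]
    exact mul_le_mul_of_nonneg_right (hC t) (norm_nonneg _)

lemma exists_translate (h : Lp ℂ 1 muplus) :
    ∃ τ : ℝ → Lp ℂ 1 muplus, Continuous τ ∧ (∃ C, ∀ s, ‖τ s‖ ≤ C) ∧
      ∀ s, (τ s : ℝ → ℂ) =ᵐ[muplus] shiftR s (h : ℝ → ℂ) := by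
  have hH : Integrable ((Set.Ioi (0 : ℝ)).indicator (h : ℝ → ℂ)) volume :=
    (integrable_indicator_iff measurableSet_Ioi).2 (L1.integrable_coeFn h)
  set H : Lp ℂ 1 (volume : Measure ℝ) := hH.toL1 _ with hHdef
  let R : Lp ℂ 1 (volume : Measure ℝ) →L[ℂ] Lp ℂ 1 muplus :=
    LpToLpRestrictCLM ℝ ℂ ℂ volume 1 (Set.Ioi 0)
  refine ⟨fun s => R (DomAddAct.mk (-s) +ᵥ H), ?_, ⟨‖R‖ * ‖H‖, fun s => ?_⟩, fun s => ?_⟩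
  · have : Fact ((1 : ENNReal) ≠ ⊤) := ⟨by simp⟩
    refine R.continuous.comp ?_
    have h2 : Continuous fun s : ℝ => DomAddAct.mk (-s) :=
      DomAddAct.continuous_mk.comp continuous_neg
    exact h2.vadd continuous_const
  · refine (R.le_opNorm _).trans ?_
    rw [DomAddAct.norm_vadd_Lp]
  · have h1 : (R (DomAddAct.mk (-s) +ᵥ H) : ℝ → ℂ) =ᵐ[muplus]
        ((DomAddAct.mk (-s) +ᵥ H : Lp ℂ 1 (volume : Measure ℝ)) : ℝ → ℂ) :=
      LpToLpRestrictCLM_coeFn ℂ (Set.Ioi 0) _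
    have h2 := DomAddAct.vadd_Lp_ae_eq (DomAddAct.mk (-s)) H
    have h3 : (H : ℝ → ℂ) =ᵐ[volume] (Set.Ioi (0 : ℝ)).indicator (h : ℝ → ℂ) :=
      Integrable.coeFn_toL1 hH
    have h4 := (measurePreserving_add_left (volume : Measure ℝ) (-s)).quasiMeasurePreserving.ae_eq_comp h3
    refine h1.trans ?_
    refine (ae_restrict_of_ae (h2.trans ?_) : _)
    filter_upwards [h4] with t ht
    rw [shiftR_eq_indicator]
    simp only [Function.comp] at ht
    rw [sub_eq_neg_add]
    exact ht

lemma integrable_case1 (f h : Lp ℂ 1 muplus) (w : ℝ → ℂ) (hw : Measurable w) (C : ℝ)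
    (hC : ∀ t, ‖w t‖ ≤ C) :
    Integrable (fun p : ℝ × ℝ => w p.1 * ((f : ℝ → ℂ) p.2 * shiftR p.2 (h : ℝ → ℂ) p.1))
      (muplus.prod muplus) := by
  have hH : Integrable ((Set.Ioi (0 : ℝ)).indicator (h : ℝ → ℂ)) volume :=
    (integrable_indicator_iff measurableSet_Ioi).2 (L1.integrable_coeFn h)
  have hF : Integrable (f : ℝ → ℂ) muplus := L1.integrable_coeFn f
  have h1 := hF.convolution_integrand (ContinuousLinearMap.mul ℂ ℂ) hH
  have h2 : muplus.prod muplus ≤ (volume : Measure ℝ).prod muplus :=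
    Measure.prod_mono Measure.restrict_le_self le_rfl
  refine Integrable.bdd_mul (c := C) ?_ (hw.comp measurable_fst).aestronglyMeasurable
    (ae_of_all _ fun p => hC p.1)
  simp_rw [shiftR_eq_indicator]
  exact h1.mono_measure h2

lemma integrable_case2 (f k : Lp ℂ 1 muplus) (g : ℝ → ℂ) (hg : Measurable g) (C : ℝ)
    (hC : ∀ t, ‖g t‖ ≤ C) :
    Integrable (fun p : ℝ × ℝ => (k : ℝ → ℂ) p.1 * ((f : ℝ → ℂ) p.2 * shiftR p.2 g p.1))
      (muplus.prod muplus) := by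
  have h1 := (L1.integrable_coeFn k).mul_prod (L1.integrable_coeFn f)
  simp_rw [shiftR_eq_indicator, ← mul_assoc]
  refine h1.mul_bdd (c := C) ?_ (ae_of_all _ fun p => ?_)
  · exact ((hg.indicator measurableSet_Ioi).comp
      (measurable_fst.sub measurable_snd)).aestronglyMeasurable
  · exact (norm_indicator_le_norm_self _ _).trans (hC _)

lemma bounded_of_C0 (g : ℝ → ℂ)
    (hgc : Continuous g) (hginf : Filter.Tendsto g Filter.atTop (nhds 0))
    (hgneg : ∀ t : ℝ, t ≤ 0 → g t = 0) : ∃ C, ∀ t, ‖g t‖ ≤ C := by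
  have h1 : ∀ᶠ t in Filter.atTop, ‖g t‖ < 1 := by
    have := hginf.norm
    rw [norm_zero] at this
    exact this.eventually (gt_mem_nhds one_pos)
  obtain ⟨M, hM⟩ := Filter.eventually_atTop.1 h1
  obtain ⟨C, hC⟩ := (isCompact_Icc (a := (0 : ℝ)) (b := M)).exists_bound_of_continuousOn
    hgc.continuousOn
  refine ⟨max C 1, fun t => ?_⟩
  by_cases h0 : t ≤ 0
  · rw [hgneg t h0, norm_zero]
    exact zero_le_one.trans (le_max_right _ _)
  · by_cases h2 : t ≤ M
    · exact (hC t ⟨(not_le.1 h0).le, h2⟩).trans (le_max_left _ _)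
    · exact (hM t (not_le.1 h2).le).le.trans (le_max_right _ _)

/-- for a Hankelian `T ∈ B(L¹(ℝ₊))`, all `h, f ∈ L¹(ℝ₊)` and
`g ∈ C₀((0,∞))` (extended by `0` outside `(0,∞)`), one has
`⟨T(h ∗ f), g⟩ = ⟨T h, f ∗ g⟩`, where `(h ∗ f)(t) = ∫₀^t h(t−s) f(s) ds` and
`(f ∗ g)(t) = ∫₀^t f(s) g(t−s) ds`. -/
theorem hankel_commutes_with_convolution (T : Lp ℂ 1 muplus →L[ℂ] Lp ℂ 1 muplus)
    (hT : IsHankelianLp 1 ∞ T) (h₀ f : Lp ℂ 1 muplus) (g : ℝ → ℂ)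
    (hgc : Continuous g) (hginf : Filter.Tendsto g Filter.atTop (nhds 0))
    (hgneg : ∀ t : ℝ, t ≤ 0 → g t = 0)
    (hf : Lp ℂ 1 muplus)
    (hhf : (hf : ℝ → ℂ) =ᵐ[muplus]
      fun t => ∫ s in Set.Ioo 0 t, (h₀ : ℝ → ℂ) (t - s) * (f : ℝ → ℂ) s) :
    ∫ t, (T hf : ℝ → ℂ) t * g t ∂muplus
      = ∫ t, (T h₀ : ℝ → ℂ) t * (∫ s in Set.Ioo 0 t, (f : ℝ → ℂ) s * g (t - s)) ∂muplus := by
  obtain ⟨C, hC⟩ := bounded_of_C0 g hgc hginf hgneg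
  obtain ⟨τ, hτc, ⟨D, hD⟩, hτ⟩ := exists_translate h₀
  have hΦ : Integrable (fun s => (f : ℝ → ℂ) s • τ s) muplus :=
    (L1.integrable_coeFn f).smul_bdd D hτc.aestronglyMeasurable (ae_of_all _ hD)
  -- the Bochner integral is the convolution
  have key : (∫ s, (f : ℝ → ℂ) s • τ s ∂muplus) = hf := by
    apply Lp.ext
    refine Integrable.ae_eq_of_forall_setIntegral_eq _ _ (L1.integrable_coeFn _)
      (L1.integrable_coeFn _) fun A hA _ => ?_
    set w : ℝ → ℂ := A.indicator (fun _ => 1) with hwdef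
    have hw : Measurable w := measurable_const.indicator hA
    have hw1 : ∀ t, ‖w t‖ ≤ 1 := fun t =>
      (norm_indicator_le_norm_self _ _).trans (by simp)
    obtain ⟨P, hP⟩ := exists_pairing w hw 1 hw1
    have hset : ∀ k : Lp ℂ 1 muplus, ∫ t in A, (k : ℝ → ℂ) t ∂muplus = P k := by
      intro k
      rw [hP, ← integral_indicator hA]
      congr 1
      ext t
      by_cases ht : t ∈ A <;> simp [hwdef, ht]
    rw [hset, hset, ← P.integral_comp_comm hΦ, hP hf]
    have e1 : ∫ t, (hf : ℝ → ℂ) t * w t ∂muplus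
        = ∫ t, w t * (∫ s in Set.Ioo 0 t, (f : ℝ → ℂ) s * (h₀ : ℝ → ℂ) (t - s)) ∂muplus := by
      apply integral_congr_ae
      filter_upwards [hhf] with t ht
      rw [ht, mul_comm]
      simp_rw [mul_comm]
    rw [e1, fubini_shift _ _ _ (integrable_case1 f h₀ w hw 1 hw1)]
    congr 1
    ext s
    rw [map_smul, smul_eq_mul, hP]
    congr 1
    apply integral_congr_ae
    filter_upwards [hτ s] with t ht
    rw [ht, mul_comm]
  obtain ⟨P, hP⟩ := exists_pairing g hgc.measurable C hC
  rw [← hP, ← key, ← T.integral_comp_comm hΦ, ← P.integral_comp_comm (T.integrable_comp hΦ),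
    fubini_shift _ _ _ (integrable_case2 f (T h₀) g hgc.measurable C hC)]
  have hpos : ∀ᵐ s ∂muplus, 0 < s := ae_restrict_mem measurableSet_Ioi
  apply integral_congr_ae
  filter_upwards [hpos] with s hs
  rw [map_smul, map_smul, smul_eq_mul, hP]
  congr 1
  have m1 : MemLp g ⊤ muplus := memLp_top_of_bound hgc.aestronglyMeasurable C (ae_of_all _ hC)
  have m2 : MemLp (shiftR s g) ⊤ muplus := by
    have : shiftR s g = fun t => (Set.Ioi (0 : ℝ)).indicator g (t - s) :=
      funext fun t => shiftR_eq_indicator s g t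
    rw [this]
    refine memLp_top_of_bound ((hgc.measurable.indicator measurableSet_Ioi).comp
      (measurable_id.sub_const s)).aestronglyMeasurable C (ae_of_all _ fun t => ?_)
    exact (norm_indicator_le_norm_self _ _).trans (hC _)
  have hsh : shiftR s (m1.toLp g : ℝ → ℂ) =ᵐ[muplus] shiftR s g := by
    have a1 : ∀ᵐ t : ℝ, t ∈ Set.Ioi (0 : ℝ) → (m1.toLp g : ℝ → ℂ) t = g t :=
      (ae_restrict_iff' measurableSet_Ioi).1 m1.coeFn_toLp
    have a2 := (measurePreserving_sub_right (volume : Measure ℝ) s).quasiMeasurePreserving.ae a1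
    refine ae_restrict_of_ae ?_
    filter_upwards [a2] with t ht
    by_cases hst : s < t
    · simp only [shiftR, hst, if_true]
      exact ht (sub_pos.2 hst)
    · simp [shiftR, hst]
  have := hT s hs h₀ (τ s) (m1.toLp g) (m2.toLp _) (hτ s) (m2.coeFn_toLp.trans hsh.symm)
  refine (integral_congr_ae ?_).trans (this.trans (integral_congr_ae ?_))
  · filter_upwards [m1.coeFn_toLp] with t ht
    rw [ht]
  · filter_upwards [m2.coeFn_toLp] with t ht
    rw [ht]
end
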